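/- For all positive real numbers λ and μ, (1/2) ∫_ℝ λ^{it−1/2} μ^{−it−1/2} / cosh(π t) dt = 1/(λ+μ), where λ^{z} denotes the principal complex power exp(z log λ). -/

import Mathlib

open MeasureTheory

/-- The bilateral Laplace transform of the logistic function, from Euler's beta integral by the
substitution `u = Real.sigmoid x`. -/
theorem integral_cexp_mul_div_one_add_exp {s : ℂ} (h0 : 0 < s.re) (h1 : s.re < 1) :
    ∫ x : ℝ, Complex.exp (s * x) / (1 + Complex.exp x) = Real.pi / Complex.sin (Real.pi * s) := by
  have hs1 : 0 < (1 - s).re := by simpa using h1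
  rw [← Complex.Gamma_mul_Gamma_one_sub, Complex.Gamma_mul_Gamma_eq_betaIntegral h0 hs1,
    add_sub_cancel, Complex.Gamma_one, one_mul, Complex.betaIntegral,
    intervalIntegral.integral_of_le zero_le_one, integral_Ioc_eq_integral_Ioo,
    ← Real.range_sigmoid, ← Set.image_univ,
    integral_image_eq_integral_abs_deriv_smul MeasurableSet.univ
      (fun x _ => (Real.hasDerivAt_sigmoid x).hasDerivWithinAt)
      Real.sigmoid_injective.injOn, setIntegral_univ]
  congr 1 with x
  have hE : 0 < Real.exp x := Real.exp_pos x
  have hp : 0 < Real.sigmoid x := Real.sigmoid_pos x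
  have hq : 0 < 1 - Real.sigmoid x := sub_pos.2 (Real.sigmoid_lt_one x)
  have hqe : 1 - Real.sigmoid x = (1 + Real.exp x)⁻¹ := by
    rw [Real.sigmoid_def, Real.exp_neg]; field_simp; ring
  have hpe : Real.sigmoid x = Real.exp x * (1 - Real.sigmoid x) := by
    rw [hqe, Real.sigmoid_def, Real.exp_neg]; field_simp; ring
  have hqc : (1 : ℂ) - Real.sigmoid x = ((1 - Real.sigmoid x : ℝ) : ℂ) := by push_cast; ring
  have hq0 : ((1 - Real.sigmoid x : ℝ) : ℂ) ≠ 0 := by exact_mod_cast hq.ne'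
  have hp0 : (Real.sigmoid x : ℂ) ≠ 0 := by exact_mod_cast hp.ne'
  have hpow : (Real.sigmoid x : ℂ) ^ s =
      Complex.exp (s * x) * ((1 - Real.sigmoid x : ℝ) : ℂ) ^ s := by
    conv_lhs => rw [hpe]
    rw [Complex.ofReal_mul, Complex.mul_cpow_ofReal_nonneg hE.le hq.le,
      Complex.cpow_def_of_ne_zero (by exact_mod_cast hE.ne'), ← Complex.ofReal_log hE.le,
      Real.log_exp, mul_comm s]
  have hinv : (1 + Complex.exp x)⁻¹ = ((1 - Real.sigmoid x : ℝ) : ℂ) := by rw [hqe]; push_cast; rfl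
  have hqs : ((1 - Real.sigmoid x : ℝ) : ℂ) ^ s ≠ 0 :=
    fun h => hq0 ((Complex.cpow_eq_zero_iff _ _).1 h).1
  rw [abs_of_pos (mul_pos hp hq), hqc, sub_sub_cancel_left, Complex.cpow_neg,
    Complex.cpow_sub _ _ hp0, Complex.cpow_one, hpow, div_eq_mul_inv, hinv, Complex.real_smul,
    Complex.ofReal_mul]
  field_simp

/-- The Fourier transform of the hyperbolic secant. -/
theorem integral_cexp_div_cosh (a : ℝ) :
    ∫ t : ℝ, Complex.exp (Complex.I * a * t) / (Real.cosh (Real.pi * t) : ℂ) =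
      1 / (Real.cosh (a / 2) : ℂ) := by
  have hpi : (Real.pi : ℂ) ≠ 0 := by exact_mod_cast Real.pi_ne_zero
  set s : ℂ := 1 / 2 + (a / (2 * Real.pi) : ℝ) * Complex.I with hs
  have hre : s.re = 1 / 2 := by simp [hs, -Complex.ofReal_div]
  have key := integral_cexp_mul_div_one_add_exp (s := s) (by rw [hre]; norm_num)
    (by rw [hre]; norm_num)
  have hsin : Complex.sin (Real.pi * s) = Complex.cosh ((a : ℂ) / 2) := by
    have : (Real.pi : ℂ) * s = (a : ℂ) / 2 * Complex.I + Real.pi / 2 := by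
      rw [hs]; push_cast; field_simp; ring
    rw [this, Complex.sin_add_pi_div_two, Complex.cos_mul_I]
  have hint (t : ℝ) : Complex.exp (Complex.I * a * t) / (Real.cosh (Real.pi * t) : ℂ) =
      2 * (Complex.exp (s * (2 * Real.pi * t : ℝ)) / (1 + Complex.exp (2 * Real.pi * t : ℝ))) := by
    have e1 : s * (2 * Real.pi * t : ℝ) = Complex.I * a * t + Real.pi * t := by
      rw [hs]; push_cast; field_simp; ring
    have e2 : 1 + Complex.exp (2 * Real.pi * t : ℝ) =
        Complex.exp (Real.pi * t) * (2 * (Real.cosh (Real.pi * t) : ℂ)) := by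
      rw [Complex.ofReal_cosh, Complex.two_cosh, mul_add, ← Complex.exp_add, ← Complex.exp_add]
      push_cast
      rw [add_neg_cancel, Complex.exp_zero, ← two_mul, ← mul_assoc, add_comm]
    have hc : (Real.cosh (Real.pi * t) : ℂ) ≠ 0 := by exact_mod_cast (Real.cosh_pos _).ne'
    have he := Complex.exp_ne_zero (Real.pi * t)
    rw [e1, e2, Complex.exp_add]
    field_simp
  simp_rw [hint]
  rw [integral_const_mul, Measure.integral_comp_mul_left
    (fun x : ℝ => Complex.exp (s * x) / (1 + Complex.exp x)), key, hsin,
    abs_of_pos (by positivity), Complex.real_smul]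
  push_cast
  field_simp

/-- For positive reals `l`, `m`:
`(1/2) ∫_ℝ l^{it-1/2} m^{-it-1/2} / cosh (π t) dt = 1 / (l + m)`,
where powers are principal complex powers. -/
theorem integral_cpow_div_cosh (l m : ℝ) (hl : 0 < l) (hm : 0 < m) :
    (1 / 2 : ℂ) * ∫ t : ℝ,
        (l : ℂ) ^ (Complex.I * t - 1 / 2) * (m : ℂ) ^ (-(Complex.I * t) - 1 / 2) /
          (Real.cosh (Real.pi * t) : ℂ) =
      1 / ((l : ℂ) + (m : ℂ)) := by
  obtain ⟨x, rfl⟩ : ∃ x, Real.exp x = l := ⟨_, Real.exp_log hl⟩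
  obtain ⟨y, rfl⟩ : ∃ y, Real.exp y = m := ⟨_, Real.exp_log hm⟩
  have hpow (z : ℝ) (w : ℂ) : (Real.exp z : ℂ) ^ w = Complex.exp (z * w) := by
    rw [Complex.cpow_def_of_ne_zero (by exact_mod_cast (Real.exp_pos z).ne'),
      ← Complex.ofReal_log (Real.exp_pos z).le, Real.log_exp]
  have hint (t : ℝ) : (Real.exp x : ℂ) ^ (Complex.I * t - 1 / 2) *
      (Real.exp y : ℂ) ^ (-(Complex.I * t) - 1 / 2) / (Real.cosh (Real.pi * t) : ℂ) =
      Complex.exp (-(x + y) / 2) *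
        (Complex.exp (Complex.I * (x - y : ℝ) * t) / (Real.cosh (Real.pi * t) : ℂ)) := by
    rw [hpow, hpow, ← Complex.exp_add, ← mul_div_assoc, ← Complex.exp_add]
    congr 2
    push_cast
    ring
  have hsum : (Real.exp x : ℂ) + Real.exp y =
      Complex.exp ((x + y) / 2) * (2 * (Real.cosh ((x - y) / 2) : ℂ)) := by
    rw [Complex.ofReal_cosh, Complex.two_cosh, mul_add, ← Complex.exp_add, ← Complex.exp_add]
    push_cast
    congr 2 <;> ring
  simp_rw [hint]
  rw [integral_const_mul, integral_cexp_div_cosh, hsum, neg_div, Complex.exp_neg]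
  field_simp
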